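/- Let Δ be a simplicial complex on X = {x_1,…,x_n}, K a field, and α = (k_1,…,k_n) ∈ ℕ^n with all k_i ≥ 1. Then the ring S/J_Δ is Cohen-Macaulay if and only if the ring S^α/J_{Δ^α} is Cohen-Macaulay. -/

import Mathlib

/-- An (abstract) simplicial complex: a collection of finite subsets of the vertex set
closed under taking subsets. -/
def IsComplex {V : Type*} (Δ : Set (Finset V)) : Prop :=
  ∀ ⦃F G : Finset V⦄, F ∈ Δ → G ⊆ F → G ∈ Δ

/-- `F` is a facet (maximal face) of `Δ`. -/
def IsFacet {V : Type*} (Δ : Set (Finset V)) (F : Finset V) : Prop :=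
  F ∈ Δ ∧ ∀ G ∈ Δ, F ⊆ G → F = G

/-- The faces of the expansion `⟨F⟩^α` of the simplex with facet `F`. -/
def simplexExpansion {V : Type*} [DecidableEq V] (F : Finset V) (α : V → ℕ) :
    Set (Finset ((v : V) × Fin (α v))) :=
  {G | G.image Sigma.fst ⊆ F ∧ Set.InjOn Sigma.fst (G : Set ((v : V) × Fin (α v)))}

/-- The expansion `Δ^α` of a simplicial complex `Δ` with respect to `α`. -/
def expansion {V : Type*} [DecidableEq V] (Δ : Set (Finset V)) (α : V → ℕ) :
    Set (Finset ((v : V) × Fin (α v))) :=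
  ⋃ F ∈ Δ, simplexExpansion F α

/-- `P_F`, the ideal generated by the variables belonging to `F`. -/
noncomputable def varIdeal (K : Type*) [Field K] {V : Type*} (F : Finset V) :
    Ideal (MvPolynomial V K) :=
  Ideal.span (MvPolynomial.X '' (F : Set V))

/-- `J_Δ = ⋂_{F ∈ 𝔉(Δ)} P_F`, the Alexander dual of the facet ideal of `Δ`. -/
noncomputable def dualFacetIdeal (K : Type*) [Field K] {V : Type*} (Δ : Set (Finset V)) :
    Ideal (MvPolynomial V K) :=
  ⨅ F ∈ {F | IsFacet Δ F}, varIdeal K F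

/-- The depth of a local ring: the supremum of the lengths of the regular sequences
contained in the maximal ideal. -/
noncomputable def localRingDepth (R : Type*) [CommRing R] [IsLocalRing R] : ℕ∞ :=
  sSup {d : ℕ∞ | ∃ rs : List R, (rs.length : ℕ∞) = d ∧
    (∀ r ∈ rs, r ∈ IsLocalRing.maximalIdeal R) ∧
    RingTheory.Sequence.IsRegular (R := R) R rs}

/-- A Cohen-Macaulay ring: a Noetherian ring such that the localization at every maximal
ideal has depth equal to its Krull dimension. -/
def IsCohenMacaulayRing (R : Type*) [CommRing R] : Prop :=
  IsNoetherianRing R ∧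
    ∀ P : Ideal R, ∀ hP : P.IsMaximal,
      haveI : P.IsPrime := hP.isPrime
      WithBot.some (localRingDepth (Localization.AtPrime P)) =
        ringKrullDim (Localization.AtPrime P)


universe u

open RingTheory.Sequence IsLocalRing CategoryTheory Abelian Limits Pointwise

/-- A local ring containing a regular sequence as long as its Krull dimension. -/
def HasMaximalRegularSequence (R : Type*) [CommRing R] [IsLocalRing R] : Prop :=
  ∃ rs : List R, (∀ r ∈ rs, r ∈ maximalIdeal R) ∧ IsWeaklyRegular R rs ∧
    ((rs.length : ℕ∞) : WithBot ℕ∞) = ringKrullDim R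

theorem length_le_ringKrullDim {R : Type*} [CommRing R] [IsLocalRing R] [IsNoetherianRing R]
    {rs : List R} (mem : ∀ r ∈ rs, r ∈ maximalIdeal R) (reg : IsWeaklyRegular R rs) :
    ((rs.length : ℕ∞) : WithBot ℕ∞) ≤ ringKrullDim R := by
  have hreg := IsRegular.of_isWeaklyRegular_of_mem_maximalIdeal _ mem reg
  have hnt : Nontrivial (R ⧸ Ideal.ofList rs) := by
    refine Ideal.Quotient.nontrivial_iff.mpr fun h ↦ hreg.top_ne_smul ?_
    simp [h]
  rw [← ringKrullDim_add_length_eq_ringKrullDim_of_isRegular rs hreg]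
  exact le_add_of_nonneg_left (ringKrullDim_nonneg_of_nontrivial)

theorem localRingDepth_eq_ringKrullDim_iff {R : Type*} [CommRing R] [IsLocalRing R]
    [IsNoetherianRing R] :
    WithBot.some (localRingDepth R) = ringKrullDim R ↔ HasMaximalRegularSequence R := by
  set s : Set ℕ∞ := {d : ℕ∞ | ∃ rs : List R, (rs.length : ℕ∞) = d ∧
    (∀ r ∈ rs, r ∈ maximalIdeal R) ∧ IsRegular (R := R) R rs}
  constructor
  · intro h
    have hlt : sSup s < ⊤ := by
      have := ringKrullDim_lt_top (R := R)
      rw [← h] at this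
      exact WithBot.coe_lt_coe.mp this
    have : Nonempty s := ⟨0, [], by simp, by simp, IsRegular.nil R R⟩
    obtain ⟨rs, hlen, mem, reg⟩ := ENat.sSup_mem_of_nonempty_of_lt_top hlt
    exact ⟨rs, mem, reg.toIsWeaklyRegular, by rw [hlen]; exact h⟩
  · rintro ⟨rs, mem, reg, hlen⟩
    rw [← hlen]
    refine congrArg WithBot.some (le_antisymm (sSup_le ?_) (le_sSup ?_))
    · rintro _ ⟨rs', rfl, mem', reg'⟩
      exact WithBot.coe_le_coe.mp (hlen ▸ length_le_ringKrullDim mem' reg'.toIsWeaklyRegular)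
    · exact ⟨rs, rfl, mem, IsRegular.of_isWeaklyRegular_of_mem_maximalIdeal _ mem reg⟩

theorem HasMaximalRegularSequence.of_ringEquiv {R S : Type*} [CommRing R] [IsLocalRing R]
    [CommRing S] [IsLocalRing S] (e : R ≃+* S) (h : HasMaximalRegularSequence R) :
    HasMaximalRegularSequence S := by
  obtain ⟨rs, mem, reg, hlen⟩ := h
  let _ := e.toRingHom.toAlgebra
  have : Module.Flat R S := RingHom.Flat.of_bijective (f := e.toRingHom) e.bijective
  refine ⟨rs.map (algebraMap R S), ?_, reg.of_flat, ?_⟩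
  · simp only [List.mem_map, forall_exists_index, and_imp, forall_apply_eq_imp_iff₂]
    intro r hr
    have hu := mem r hr
    rw [mem_maximalIdeal, mem_nonunits_iff] at hu ⊢
    exact fun h ↦ hu ((MulEquiv.isUnit_map e).mp h)
  · rw [List.length_map, hlen, ringKrullDim_eq_of_ringEquiv e]

theorem exists_isRegular_quotSMulTop {R : Type u} [CommRing R] [IsLocalRing R]
    [IsNoetherianRing R] {x : R} (hx : x ∈ maximalIdeal R) (hreg : IsSMulRegular R x)
    {rs : List R} (mem : ∀ r ∈ rs, r ∈ maximalIdeal R) (reg : IsRegular R rs) :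
    ∃ rs' : List R, rs'.length = rs.length - 1 ∧ (∀ r ∈ rs', r ∈ maximalIdeal R) ∧
      IsRegular (QuotSMulTop x R) rs' := by
  let M := ModuleCat.of R R
  let N := ModuleCat.of R (R ⧸ maximalIdeal R)
  have hsupp : Module.support R N = PrimeSpectrum.zeroLocus (maximalIdeal R) := by
    change Module.support R (R ⧸ maximalIdeal R) = _
    rw [Module.support_eq_zeroLocus, Ideal.annihilator_quotient]
  have hreg' : IsSMulRegular M x := hreg
  have hne : Nontrivial (QuotSMulTop x R) := nontrivial_quotSMulTop_of_mem_maximalIdeal _ hx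
  have hlt : ∀ (L : Type u) [AddCommGroup L] [Module R L] [Module.Finite R L] [Nontrivial L],
      maximalIdeal R • (⊤ : Submodule R L) < ⊤ := fun L _ _ _ _ ↦
    (Submodule.top_ne_ideal_smul_of_le_jacobson_annihilator
      (maximalIdeal_le_jacobson _)).symm.lt_top
  have hext := ModuleCat.subsingleton_ext_of_exists_isRegular (maximalIdeal R) N hsupp.subset M
    (hlt R) rs mem reg
  refine ModuleCat.exists_isRegular_of_exists_subsingleton_ext (maximalIdeal R) _
    (ModuleCat.of R (QuotSMulTop x M)) (hlt (QuotSMulTop x R)) N hsupp fun i hi ↦ ?_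
  have zero1 := AddCommGrpCat.isZero_of_iff_subsingleton.mpr (hext i (by omega))
  have zero2 := AddCommGrpCat.isZero_of_iff_subsingleton.mpr (hext (i + 1) (by omega))
  exact AddCommGrpCat.subsingleton_of_isZero <| ShortComplex.Exact.isZero_of_both_zeros
    ((Ext.covariant_sequence_exact₃' N hreg'.smulShortComplex_shortExact) i (i + 1) rfl)
    (zero1.eq_zero_of_src _) (zero2.eq_zero_of_tgt _)

theorem HasMaximalRegularSequence.quotient_span_singleton {R : Type u} [CommRing R]
    [IsLocalRing R] [IsNoetherianRing R] {x : R} (hx : x ∈ maximalIdeal R)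
    (hreg : IsSMulRegular R x) [IsLocalRing (R ⧸ Ideal.span {x})]
    (h : HasMaximalRegularSequence R) : HasMaximalRegularSequence (R ⧸ Ideal.span {x}) := by
  obtain ⟨rs, mem, reg, hlen⟩ := h
  obtain ⟨rs', hlen', mem', reg'⟩ := exists_isRegular_quotSMulTop hx hreg mem
    (IsRegular.of_isWeaklyRegular_of_mem_maximalIdeal _ mem reg)
  have hdim := ringKrullDim_quotient_span_singleton_succ_eq_ringKrullDim hreg hx
  have hnn : (0 : WithBot ℕ∞) ≤ ringKrullDim (R ⧸ Ideal.span {x}) :=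
    ringKrullDim_nonneg_of_nontrivial
  refine ⟨rs'.map (algebraMap R _), ?_, ?_, ?_⟩
  · simp only [List.mem_map, forall_exists_index, and_imp, forall_apply_eq_imp_iff₂]
    intro r hr
    have : IsLocalHom (Ideal.Quotient.mk (Ideal.span {x})) :=
      .of_surjective _ Ideal.Quotient.mk_surjective
    exact (map_mem_nonunits_iff (Ideal.Quotient.mk (Ideal.span {x})) r).mpr (mem' r hr)
  · rw [isWeaklyRegular_map_algebraMap_iff]
    refine (LinearEquiv.isWeaklyRegular_congr
      (Submodule.quotEquivOfEq _ _ ?_) rs').mp reg'.toIsWeaklyRegular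
    simp [← Submodule.ideal_span_singleton_smul]
  · rw [List.length_map, hlen']
    rw [← hlen] at hdim
    generalize ringKrullDim (R ⧸ Ideal.span {x}) = d at hdim hnn ⊢
    induction d with
    | bot => simp at hnn
    | coe d =>
      have hd : d + 1 = (rs.length : ℕ∞) := by exact_mod_cast hdim
      induction d with
      | top => simp at hd
      | coe d =>
        have hd' : d + 1 = rs.length := by exact_mod_cast hd
        rw [← hd', Nat.add_sub_cancel]

theorem IsCohenMacaulayRing.isNoetherianRing {R : Type*} [CommRing R]
    (h : IsCohenMacaulayRing R) : IsNoetherianRing R := h.1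

theorem isCohenMacaulayRing_iff {R : Type*} [CommRing R] [IsNoetherianRing R] :
    IsCohenMacaulayRing R ↔ ∀ (P : Ideal R) [P.IsMaximal],
      HasMaximalRegularSequence (Localization.AtPrime P) := by
  refine ⟨fun h P hP ↦ ?_, fun h ↦ ⟨‹_›, fun P hP ↦ ?_⟩⟩
  · have : IsNoetherianRing (Localization.AtPrime P) :=
      IsLocalization.isNoetherianRing P.primeCompl _ ‹_›
    exact localRingDepth_eq_ringKrullDim_iff.mp (h.2 P hP)
  · have : IsNoetherianRing (Localization.AtPrime P) :=
      IsLocalization.isNoetherianRing P.primeCompl _ ‹_›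
    exact localRingDepth_eq_ringKrullDim_iff.mpr (h P)

theorem IsCohenMacaulayRing.of_ringEquiv {R S : Type*} [CommRing R] [CommRing S] (e : R ≃+* S)
    (h : IsCohenMacaulayRing R) : IsCohenMacaulayRing S := by
  have := h.isNoetherianRing
  have : IsNoetherianRing S := isNoetherianRing_of_ringEquiv R e
  rw [isCohenMacaulayRing_iff] at h ⊢
  intro P hP
  have : (P.comap e).IsMaximal := Ideal.comap_isMaximal_of_equiv e
  exact (h (P.comap e)).of_ringEquiv (Localization.localRingEquiv _ P e rfl)

theorem isCohenMacaulayRing_congr {R S : Type*} [CommRing R] [CommRing S] (e : R ≃+* S) :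
    IsCohenMacaulayRing R ↔ IsCohenMacaulayRing S :=
  ⟨.of_ringEquiv e, .of_ringEquiv e.symm⟩

theorem IsCohenMacaulayRing.quotient_span_singleton {R : Type*} [CommRing R] {x : R}
    (hx : IsSMulRegular R x) (h : IsCohenMacaulayRing R) :
    IsCohenMacaulayRing (R ⧸ Ideal.span {x}) := by
  have := h.isNoetherianRing
  rw [isCohenMacaulayRing_iff] at h ⊢
  intro P hP
  let Q := P.comap (Ideal.Quotient.mk (Ideal.span {x}))
  have hQ : Q.IsMaximal := Ideal.comap_isMaximal_of_surjective _ Ideal.Quotient.mk_surjective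
  let A := Localization.AtPrime Q
  have : IsNoetherianRing A := IsLocalization.isNoetherianRing Q.primeCompl _ ‹_›
  have hxQ : x ∈ Q := by
    have : Ideal.Quotient.mk (Ideal.span {x}) x = 0 :=
      Ideal.Quotient.eq_zero_iff_mem.mpr (Ideal.mem_span_singleton_self x)
    simp [Q, Ideal.mem_comap, this]
  have hmem : algebraMap R A x ∈ maximalIdeal A :=
    (IsLocalization.AtPrime.to_map_mem_maximal_iff A Q x).mpr hxQ
  have hreg : IsSMulRegular A (algebraMap R A x) := by
    have : IsWeaklyRegular R [x] := (isWeaklyRegular_singleton_iff R x).mpr hx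
    exact (isWeaklyRegular_singleton_iff A _).mp (this.of_isLocalization A Q.primeCompl)
  have hmap : (Ideal.span {x}).map (algebraMap R A) = Ideal.span {algebraMap R A x} := by
    rw [Ideal.map_span, Set.image_singleton]
  have hsub : Algebra.algebraMapSubmonoid (R ⧸ Ideal.span {x}) Q.primeCompl = P.primeCompl := by
    ext y
    obtain ⟨y, rfl⟩ := Ideal.Quotient.mk_surjective y
    constructor
    · rintro ⟨z, hz, hzy⟩ hy
      exact hz (show Ideal.Quotient.mk _ z ∈ P by
        change Ideal.Quotient.mk _ z = _ at hzy
        rwa [hzy])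
    · exact fun hy ↦ ⟨y, hy, rfl⟩
  have hloc : IsLocalization P.primeCompl (A ⧸ (Ideal.span {x}).map (algebraMap R A)) := by
    rw [← hsub]
    infer_instance
  let e : Localization.AtPrime P ≃+* A ⧸ Ideal.span {algebraMap R A x} :=
    (IsLocalization.algEquiv P.primeCompl (Localization.AtPrime P)
      (A ⧸ (Ideal.span {x}).map (algebraMap R A))).toRingEquiv.trans (Ideal.quotEquivOfEq hmap)
  have : IsLocalRing (A ⧸ Ideal.span {algebraMap R A x}) := e.isLocalRing
  exact ((h Q).quotient_span_singleton hmem hreg).of_ringEquiv e.symm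


open Polynomial in
theorem Polynomial.Monic.mem_map_C_of_mul_mem {R : Type*} [CommRing R] {J : Ideal R} {f g : R[X]}
    (hf : f.Monic) (h : f * g ∈ J.map C) : g ∈ J.map C := by
  have hker : RingHom.ker (mapRingHom (Ideal.Quotient.mk J)) = J.map C := by
    rw [ker_mapRingHom, Ideal.mk_ker]
  rw [← hker, RingHom.mem_ker] at h ⊢
  rw [map_mul] at h
  exact (hf.map (Ideal.Quotient.mk J)).mul_right_eq_zero_iff.mp h

open Polynomial in
theorem Ideal.exists_monic_mem_of_isMaximal {R : Type*} [CommRing R] [IsJacobsonRing R]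
    (P : Ideal R[X]) [P.IsMaximal] : ∃ f ∈ P, f.Monic := by
  obtain ⟨f, hf, hf0⟩ := quotient_mk_comp_C_isIntegral_of_isJacobsonRing P (Ideal.Quotient.mk P X)
  refine ⟨f, ?_, hf⟩
  rwa [← hom_eval₂, eval₂_C_X, Ideal.Quotient.eq_zero_iff_mem] at hf0

open Polynomial in
theorem IsCohenMacaulayRing.polynomial {R : Type*} [CommRing R] [IsJacobsonRing R]
    (h : IsCohenMacaulayRing R) : IsCohenMacaulayRing R[X] := by
  have := h.isNoetherianRing
  rw [isCohenMacaulayRing_iff] at h ⊢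
  intro P hP
  let p := P.comap C
  have hp : p.IsMaximal := isMaximal_comap_C_of_isJacobsonRing P
  have hlies : P.LiesOver p := ⟨rfl⟩
  let A := Localization.AtPrime p
  let B := Localization.AtPrime P
  obtain ⟨rs, mem, reg, hlen⟩ := h p
  let φ : A →+* B := Localization.localRingHom p P C rfl
  have hφ : φ.Flat := RingHom.Flat.localRingHom
    (RingHom.flat_algebraMap_iff.mpr (inferInstanceAs (Module.Flat R R[X]))) P p rfl
  let _ : Algebra A B := φ.toAlgebra
  have hflat : Module.Flat A B := hφ
  have hφC (r : R) : φ (algebraMap R A r) = algebraMap R[X] B (C r) :=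
    Localization.localRingHom_to_map p P C rfl r
  obtain ⟨f, hfP, hf⟩ := P.exists_monic_mem_of_isMaximal
  refine ⟨rs.map φ ++ [algebraMap R[X] B f], ?_, ?_, ?_⟩
  · simp only [List.mem_append, List.mem_map, List.mem_singleton]
    rintro _ (⟨r, hr, rfl⟩ | rfl)
    · exact (map_mem_nonunits_iff φ r).mpr (mem r hr)
    · exact (IsLocalization.AtPrime.to_map_mem_maximal_iff B P f).mpr hfP
  · rw [isWeaklyRegular_append_iff, isWeaklyRegular_singleton_iff]
    refine ⟨reg.of_flat (S := B), ?_⟩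
    rw [isSMulRegular_quotient_iff_mem_of_smul_mem]
    intro b hb
    let J := (Ideal.ofList rs).comap (algebraMap R A)
    have hJ : Ideal.ofList (rs.map φ) • (⊤ : Ideal B) = (J.map C).map (algebraMap R[X] B) := by
      rw [smul_eq_mul, Ideal.mul_top, ← Ideal.map_ofList,
        ← IsLocalization.map_under p.primeCompl A (Ideal.ofList rs), Ideal.map_map, Ideal.map_map]
      congr 1
      exact RingHom.ext hφC
    rw [hJ] at hb ⊢
    obtain ⟨g, s, rfl⟩ := IsLocalization.exists_mk'_eq P.primeCompl b
    rw [smul_eq_mul, IsLocalization.mul_mk'_eq_mk'_of_mul,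
      IsLocalization.mk'_mem_map_algebraMap_iff] at hb
    rw [IsLocalization.mk'_mem_map_algebraMap_iff]
    obtain ⟨t, ht, htg⟩ := hb
    exact ⟨t, ht, hf.mem_map_C_of_mul_mem (by convert htg using 1; ring)⟩
  · rw [IsLocalization.AtPrime.ringKrullDim_eq_height P, height_eq_height_add_one p P,
      WithBot.coe_add, ← IsLocalization.AtPrime.ringKrullDim_eq_height p A, ← hlen]
    simp

section HyperbolaRing

open Polynomial

theorem isSMulRegular_C_X_mul_X_sub_C {R : Type*} [CommRing R] (a : R) :
    IsSMulRegular R[X][X] (C X * X - C (C a) : R[X][X]) := by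
  intro p q hpq
  nontriviality R
  have hlead : (C X * X - C (C a) : R[X][X]).leadingCoeff ∈ nonZeroDivisors R[X] := by
    rw [sub_eq_add_neg, ← C_neg, leadingCoeff_linear X_ne_zero]
    exact monic_X.mem_nonZeroDivisors
  exact (isRegular_iff_mem_nonZeroDivisors.mpr
    (mem_nonZeroDivisors_of_leadingCoeff hlead)).left hpq

variable {R Q : Type*} [CommRing R] [CommRing Q] {a : R} {g : R[X][X] →+* Q}

theorem isSMulRegular_map_C_X_sub_one (hg : Function.Surjective g)
    (hker : RingHom.ker g = Ideal.span {C X * X - C (C a)}) :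
    IsSMulRegular Q (g (C (X - C 1))) := by
  rw [isSMulRegular_iff_right_eq_zero_of_smul]
  intro q hq
  obtain ⟨q, rfl⟩ := hg q
  rw [smul_eq_mul, ← map_mul, ← RingHom.mem_ker, hker, Ideal.mem_span_singleton] at hq
  obtain ⟨h, hh⟩ := hq
  have hh0 : mapRingHom (evalRingHom (1 : R)) h = 0 := by
    have := congrArg (mapRingHom (evalRingHom (1 : R))) hh
    simp only [map_mul, map_sub, coe_mapRingHom, map_C, map_X, coe_evalRingHom, eval_X, eval_C,
      sub_self, map_one, zero_mul, one_mul] at this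
    exact (monic_X_sub_C a).mul_right_eq_zero_iff.mp this.symm
  rw [← RingHom.mem_ker, ker_mapRingHom, ker_evalRingHom, Ideal.map_span, Set.image_singleton,
    Ideal.mem_span_singleton] at hh0
  obtain ⟨k, rfl⟩ := hh0
  rw [← RingHom.mem_ker, hker, Ideal.mem_span_singleton]
  refine ⟨k, ?_⟩
  have hz : C (X - C 1) * (q - (C X * X - C (C a)) * k) = 0 := by
    rw [mul_sub, hh]
    ring
  ext1 n
  have := congrArg (coeff · n) hz
  simp only [coeff_C_mul, coeff_zero] at this
  have := (monic_X_sub_C (1 : R)).mul_right_eq_zero_iff.mp this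
  rwa [coeff_sub, sub_eq_zero] at this

/-- The ring `R[s, t] / (s t - a)` modulo `s - 1` is `R`. -/
theorem nonempty_quotient_span_map_C_X_sub_one_ringEquiv (hg : Function.Surjective g)
    (hker : RingHom.ker g = Ideal.span {C X * X - C (C a)}) :
    Nonempty (Q ⧸ Ideal.span {g (C (X - C 1))} ≃+* R) := by
  let ev : R[X][X] →+* R := (evalRingHom 1).comp (evalRingHom (C a))
  have hev : RingHom.ker g ≤ RingHom.ker ev := by
    rw [hker, Ideal.span_singleton_le_iff_mem, RingHom.mem_ker]
    simp [ev]
  let F : Q →+* R := RingHom.liftOfSurjective g hg ⟨ev, hev⟩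
  have hFg (q : R[X][X]) : F (g q) = ev q := RingHom.liftOfRightInverse_comp_apply _ _ _ _ q
  have hF : Function.Surjective F := fun r ↦ ⟨g (C (C r)), by rw [hFg]; simp [ev]⟩
  have hkerF : RingHom.ker F = Ideal.span {g (C (X - C 1))} := by
    apply le_antisymm
    · intro q hq
      obtain ⟨q, rfl⟩ := hg q
      rw [RingHom.mem_ker, hFg] at hq
      have hq : IsRoot (eval (C a) q) 1 := hq
      obtain ⟨u, hu⟩ := dvd_iff_isRoot.mpr hq
      obtain ⟨v, hv⟩ : X - C (C a) ∣ q - C (eval (C a) q) := X_sub_C_dvd_sub_C_eval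
      have hq' : q = C (X - C 1) * (C u - X * v) + (C X * X - C (C a)) * v := by
        rw [eq_add_of_sub_eq hv, hu]
        simp only [map_mul, map_sub, map_one]
        ring
      have hmem : (C X * X - C (C a)) * v ∈ RingHom.ker g :=
        hker ▸ Ideal.mul_mem_right _ _ (Ideal.mem_span_singleton_self _)
      rw [Ideal.mem_span_singleton, hq', map_add, map_mul, RingHom.mem_ker.mp hmem, add_zero]
      exact dvd_mul_right _ _
    · rw [Ideal.span_singleton_le_iff_mem, RingHom.mem_ker, hFg]
      simp [ev]
  exact ⟨(Ideal.quotEquivOfEq hkerF.symm).trans (RingHom.quotientKerEquivOfSurjective hF)⟩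

theorem isCohenMacaulayRing_iff_of_ker_eq_span [IsJacobsonRing R] (hg : Function.Surjective g)
    (hker : RingHom.ker g = Ideal.span {C X * X - C (C a)}) :
    IsCohenMacaulayRing Q ↔ IsCohenMacaulayRing R := by
  constructor
  · intro h
    obtain ⟨e⟩ := nonempty_quotient_span_map_C_X_sub_one_ringEquiv hg hker
    exact (h.quotient_span_singleton (isSMulRegular_map_C_X_sub_one hg hker)).of_ringEquiv e
  · intro h
    have hq := h.polynomial.polynomial.quotient_span_singleton (isSMulRegular_C_X_mul_X_sub_C a)
    rw [← hker] at hq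
    exact hq.of_ringEquiv (RingHom.quotientKerEquivOfSurjective hg)

end HyperbolaRing

/-- The `K`-algebra map sending each variable to the product of the variables in its fibre. -/
noncomputable def fiberProd (K : Type*) [Field K] {V W : Type*} [DecidableEq V] [Fintype W]
    (π : W → V) : MvPolynomial V K →ₐ[K] MvPolynomial W K :=
  MvPolynomial.aeval fun v ↦ ∏ w with π w = v, MvPolynomial.X w

@[simp]
theorem fiberProd_X (K : Type*) [Field K] {V W : Type*} [DecidableEq V] [Fintype W]
    (π : W → V) (v : V) :
    fiberProd K π (MvPolynomial.X v) = ∏ w with π w = v, MvPolynomial.X w :=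
  MvPolynomial.aeval_X _ _

section Facets

variable {V : Type*} [DecidableEq V] {Δ : Set (Finset V)} {α : V → ℕ}

theorem IsFacet.image_fst (hΔ : IsComplex Δ) (hα : ∀ v, 1 ≤ α v)
    {G : Finset ((v : V) × Fin (α v))} (hG : IsFacet (expansion Δ α) G) :
    IsFacet Δ (G.image Sigma.fst) := by
  obtain ⟨hmem, hmax⟩ := hG
  simp only [expansion, Set.mem_iUnion] at hmem
  obtain ⟨F, hF, hGF, hinj⟩ := hmem
  refine ⟨hΔ hF hGF, fun F' hF' hsub ↦ hsub.antisymm fun v hv ↦ ?_⟩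
  by_contra hvG
  have hins : insert ⟨v, ⟨0, hα v⟩⟩ G ∈ expansion Δ α := by
    simp only [expansion, Set.mem_iUnion]
    refine ⟨F', hF', ?_, ?_⟩
    · rw [Finset.image_insert]
      exact Finset.insert_subset hv hsub
    · rw [Finset.coe_insert, Set.injOn_insert (fun h ↦ hvG (Finset.mem_image_of_mem _ h))]
      refine ⟨hinj, ?_⟩
      rintro ⟨w, hw, hwv⟩
      exact hvG (Finset.mem_image.mpr ⟨w, hw, hwv⟩)
  have heq := hmax _ hins (Finset.subset_insert _ _)
  exact hvG (Finset.mem_image.mpr ⟨⟨v, ⟨0, hα v⟩⟩, heq ▸ Finset.mem_insert_self _ _, rfl⟩)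

theorem IsFacet.image_mk {F : Finset V} (hF : IsFacet Δ F) (j : (v : V) → Fin (α v)) :
    IsFacet (expansion Δ α) (F.image fun v ↦ ⟨v, j v⟩) := by
  constructor
  · simp only [expansion, Set.mem_iUnion]
    refine ⟨F, hF.1, ?_, ?_⟩
    · simp [Finset.image_image, Function.comp_def]
    · rw [Finset.coe_image]
      rintro _ ⟨v, _, rfl⟩ _ ⟨w, _, rfl⟩ (rfl : v = w)
      rfl
  · intro H hH hsub
    simp only [expansion, Set.mem_iUnion] at hH
    obtain ⟨F', hF', hHF', hinj⟩ := hH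
    have hFF' : F ⊆ F' := fun v hv ↦ hHF' <| Finset.mem_image.mpr
      ⟨⟨v, j v⟩, hsub (Finset.mem_image_of_mem _ hv), rfl⟩
    obtain rfl := hF.2 F' hF' hFF'
    refine hsub.antisymm fun h hh ↦ ?_
    have hmem : (⟨h.1, j h.1⟩ : (v : V) × Fin (α v)) ∈ F.image fun v ↦ ⟨v, j v⟩ :=
      Finset.mem_image_of_mem _ (hHF' (Finset.mem_image_of_mem _ hh))
    rwa [← hinj (hsub hmem) hh rfl]

end Facets

theorem MvPolynomial.prod_X_dvd_monomial {R σ : Type*} [CommSemiring R] {s : Finset σ}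
    {m : σ →₀ ℕ} (h : ∀ i ∈ s, m i ≠ 0) (c : R) :
    ∏ i ∈ s, X i ∣ monomial m c := by
  classical
  have : ∏ i ∈ s, X i = monomial (∑ i ∈ s, Finsupp.single i 1) (1 : R) := by
    rw [monomial_sum_one]
    rfl
  rw [this, monomial_dvd_monomial]
  refine ⟨Or.inr fun i ↦ ?_, one_dvd c⟩
  simp only [Finsupp.coe_finsetSum, Finset.sum_apply, Finsupp.single_apply]
  rw [Finset.sum_ite_eq']
  split_ifs with hi
  · exact Nat.one_le_iff_ne_zero.mpr (h i hi)
  · exact Nat.zero_le _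

theorem mem_varIdeal {K V : Type*} [Field K] {F : Finset V} {p : MvPolynomial V K} :
    p ∈ varIdeal K F ↔ ∀ m ∈ p.support, ∃ v ∈ F, m v ≠ 0 :=
  MvPolynomial.mem_ideal_span_X_image

theorem mem_dualFacetIdeal {K V : Type*} [Field K] {Δ : Set (Finset V)} {p : MvPolynomial V K} :
    p ∈ dualFacetIdeal K Δ ↔ ∀ F, IsFacet Δ F → p ∈ varIdeal K F := by
  simp [dualFacetIdeal]

/-- The ideal `J_{Δ^α}` is extended from `J_Δ` along `x_v ↦ ∏ j, x_{v j}`. -/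
theorem dualFacetIdeal_expansion {K V : Type*} [Field K] [DecidableEq V] [Fintype V]
    {Δ : Set (Finset V)} (hΔ : IsComplex Δ) {α : V → ℕ} (hα : ∀ v, 1 ≤ α v) :
    dualFacetIdeal K (expansion Δ α) =
      (dualFacetIdeal K Δ).map (fiberProd K (Sigma.fst : (v : V) × Fin (α v) → V)) := by
  apply le_antisymm
  · intro p hp
    rw [MvPolynomial.as_sum p]
    refine Ideal.sum_mem _ fun m hm ↦ ?_
    let T : Finset V := {v | ∀ j, m ⟨v, j⟩ ≠ 0}
    have hT : ∏ v ∈ T, MvPolynomial.X v ∈ dualFacetIdeal K Δ := by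
      rw [mem_dualFacetIdeal]
      intro F hF
      obtain ⟨v, hvF, hvT⟩ : ∃ v ∈ F, v ∈ T := by
        by_contra! hcon
        have hj : ∀ v, ∃ j : Fin (α v), v ∈ F → m ⟨v, j⟩ = 0 := fun v ↦ by
          by_cases hv : v ∈ F
          · simpa [T, hv] using hcon v hv
          · exact ⟨⟨0, hα v⟩, fun h ↦ absurd h hv⟩
        choose j hj using hj
        obtain ⟨w, hw, hmw⟩ := mem_varIdeal.mp (mem_dualFacetIdeal.mp hp _ (hF.image_mk j)) m hm
        obtain ⟨v, hv, rfl⟩ := Finset.mem_image.mp hw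
        exact hmw (hj v hv)
      exact Ideal.mem_of_dvd _ (Finset.dvd_prod_of_mem _ hvT)
        (Ideal.subset_span (Set.mem_image_of_mem _ hvF))
    refine Ideal.mem_of_dvd _ ?_ (Ideal.mem_map_of_mem _ hT)
    have hprod : fiberProd K (Sigma.fst : (v : V) × Fin (α v) → V) (∏ v ∈ T, MvPolynomial.X v) =
        ∏ w : (v : V) × Fin (α v) with w.1 ∈ T, MvPolynomial.X w := by
      rw [map_prod, ← Finset.prod_fiberwise_of_maps_to (t := T) (g := Sigma.fst) (by simp)]
      refine Finset.prod_congr rfl fun v hv ↦ ?_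
      rw [fiberProd_X, Finset.filter_filter]
      refine Finset.prod_congr (Finset.filter_congr fun w _ ↦ ?_) fun _ _ ↦ rfl
      exact ⟨fun h ↦ ⟨h ▸ hv, h⟩, And.right⟩
    rw [hprod]
    refine MvPolynomial.prod_X_dvd_monomial (fun w hw ↦ ?_) _
    exact (Finset.mem_filter.mp (Finset.mem_filter.mp hw).2).2 w.2
  · rw [Ideal.map_le_iff_le_comap]
    intro p hp
    rw [Ideal.mem_comap, mem_dualFacetIdeal]
    intro G hG
    have hpG := mem_dualFacetIdeal.mp hp _ (hG.image_fst hΔ hα)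
    have hle : (varIdeal K (G.image Sigma.fst)).map
        (fiberProd K (Sigma.fst : (v : V) × Fin (α v) → V)) ≤ varIdeal K G := by
      rw [varIdeal, Ideal.map_span, Ideal.span_le]
      rintro _ ⟨_, ⟨v, hv, rfl⟩, rfl⟩
      obtain ⟨w, hw, rfl⟩ := Finset.mem_image.mp hv
      rw [SetLike.mem_coe, fiberProd_X]
      exact Ideal.mem_of_dvd _ (Finset.dvd_prod_of_mem MvPolynomial.X (by simp))
        (Ideal.subset_span (Set.mem_image_of_mem _ hw))
    exact hle (Ideal.mem_map_of_mem _ hpG)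

section Split

variable (K : Type*) [Field K] {W : Type*} [DecidableEq W]

/-- The map of polynomial rings replacing the variable `x_{w₁}` by `x_{w₁} * x_{w₂}`. -/
noncomputable def splitVariable {w₁ w₂ : W} (h : w₁ ≠ w₂) :
    MvPolynomial {w // w ≠ w₂} K →ₐ[K] MvPolynomial W K :=
  MvPolynomial.aeval fun w ↦
    MvPolynomial.X w.1 * if w = ⟨w₁, h⟩ then MvPolynomial.X w₂ else 1

variable {K}

theorem splitVariable_C {w₁ w₂ : W} (h : w₁ ≠ w₂) (k : K) :
    splitVariable K h (MvPolynomial.C k) = MvPolynomial.C k :=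
  MvPolynomial.aeval_C _ _

theorem splitVariable_X {w₁ w₂ : W} (h : w₁ ≠ w₂) (w : {w // w ≠ w₂}) :
    splitVariable K h (MvPolynomial.X w) =
      MvPolynomial.X w.1 * if w = ⟨w₁, h⟩ then MvPolynomial.X w₂ else 1 :=
  MvPolynomial.aeval_X _ _

open Polynomial in
theorem exists_surjective_ker_eq_span_of_splitVariable {w₁ w₂ : W} (h : w₁ ≠ w₂)
    {R Q : Type*} [CommRing R] [CommRing Q] {r : MvPolynomial {w // w ≠ w₂} K →+* R}
    (hr : Function.Surjective r) {q : MvPolynomial W K →+* Q} (hq : Function.Surjective q)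
    (hqr : RingHom.ker q = (RingHom.ker r).map (splitVariable K h)) :
    ∃ g : R[X][X] →+* Q, Function.Surjective g ∧
      RingHom.ker g = Ideal.span {C X * X - C (C (r (MvPolynomial.X ⟨w₁, h⟩)))} := by
  let ρ : R →+* Q := RingHom.liftOfSurjective r hr
    ⟨q.comp (splitVariable K h : _ →+* MvPolynomial W K), by
      rw [← RingHom.comap_ker, hqr]
      exact Ideal.le_comap_map⟩
  have hρ (p) : ρ (r p) = q (splitVariable K h p) :=
    RingHom.liftOfRightInverse_comp_apply _ _ _ _ p
  let g : R[X][X] →+* Q :=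
    eval₂RingHom (eval₂RingHom ρ (q (MvPolynomial.X w₁))) (q (MvPolynomial.X w₂))
  have hgCC (p) : g (C (C (r p))) = q (splitVariable K h p) := by simp [g, hρ]
  have hgCX : g (C X) = q (MvPolynomial.X w₁) := by simp [g]
  have hgX : g X = q (MvPolynomial.X w₂) := by simp [g]
  refine ⟨g, fun p ↦ ?_, le_antisymm ?_ ?_⟩
  · obtain ⟨p, rfl⟩ := hq p
    rw [← RingHom.mem_range]
    induction p using MvPolynomial.induction_on with
    | C k => exact ⟨C (C (r (MvPolynomial.C k))), by rw [hgCC, splitVariable_C]⟩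
    | add p p' hp hp' => rw [map_add]; exact add_mem hp hp'
    | mul_X p w hp =>
      rw [map_mul]
      refine mul_mem hp ?_
      by_cases hw₂ : w = w₂
      · exact ⟨X, by rw [hgX, hw₂]⟩
      · by_cases hw₁ : w = w₁
        · exact ⟨C X, by rw [hgCX, hw₁]⟩
        · exact ⟨C (C (r (MvPolynomial.X ⟨w, hw₂⟩))), by
            rw [hgCC, splitVariable_X, if_neg (by simpa using hw₁), mul_one]⟩
  · let J := Ideal.span {(C X * X - C (C (r (MvPolynomial.X ⟨w₁, h⟩))) : R[X][X])}
    let m : R[X][X] →+* R[X][X] ⧸ J := Ideal.Quotient.mk J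
    let c : MvPolynomial {w // w ≠ w₂} K →+* R[X][X] := (C.comp C).comp r
    let x (w : W) : R[X][X] :=
      if hw : w ≠ w₂ then if w = w₁ then C X else c (MvPolynomial.X ⟨w, hw⟩) else X
    have hx₁ : x w₁ = C X := by simp [x, h]
    have hx₂ : x w₂ = X := by simp [x]
    have hm : m (C X * X) = m (c (MvPolynomial.X ⟨w₁, h⟩)) :=
      Ideal.Quotient.eq.mpr (Ideal.mem_span_singleton_self _)
    let F₀ : MvPolynomial W K →+* R[X][X] ⧸ J :=
      MvPolynomial.eval₂Hom ((m.comp c).comp MvPolynomial.C) fun w ↦ m (x w)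
    have hF₀X (w) : F₀ (MvPolynomial.X w) = m (x w) := MvPolynomial.eval₂Hom_X' _ _ w
    have hF₀ : F₀.comp (splitVariable K h : _ →+* MvPolynomial W K) = m.comp c := by
      refine MvPolynomial.ringHom_ext (fun k ↦ ?_) fun w ↦ ?_
      · rw [RingHom.comp_apply, RingHom.coe_coe, splitVariable_C]
        exact MvPolynomial.eval₂Hom_C _ _ k
      · rw [RingHom.comp_apply, RingHom.coe_coe, RingHom.comp_apply, splitVariable_X]
        by_cases hw : w = ⟨w₁, h⟩
        · rw [if_pos hw, map_mul, hF₀X, hF₀X, hw, hx₁, hx₂, ← map_mul, hm]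
        · have hw' : w.1 ≠ w₁ := fun h' ↦ hw (Subtype.ext h')
          have hxw : x w = c (MvPolynomial.X w) := by simp [x, w.2, hw']
          rw [if_neg hw, mul_one, hF₀X, hxw]
    let F : Q →+* R[X][X] ⧸ J := RingHom.liftOfSurjective q hq ⟨F₀, by
      rw [hqr, Ideal.map_le_iff_le_comap]
      intro p hp
      have hp' : F₀ (splitVariable K h p) = m (c p) := congrArg (· p) hF₀
      rw [Ideal.mem_comap, RingHom.mem_ker, hp']
      simp [c, RingHom.mem_ker.mp hp]⟩
    have hFq (p) : F (q p) = F₀ p := RingHom.liftOfRightInverse_comp_apply _ _ _ _ p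
    have hFg : F.comp g = m := by
      refine Polynomial.ringHom_ext' (Polynomial.ringHom_ext' (RingHom.ext fun a ↦ ?_) ?_) ?_
      · obtain ⟨p, rfl⟩ := hr a
        simp only [RingHom.comp_apply]
        rw [hgCC, hFq]
        exact congrArg (· p) hF₀
      · simp only [RingHom.comp_apply]
        rw [hgCX, hFq, hF₀X, hx₁]
      · rw [RingHom.comp_apply, hgX, hFq, hF₀X, hx₂]
    intro p hp
    rw [← Ideal.Quotient.eq_zero_iff_mem]
    change m p = 0
    rw [← hFg, RingHom.comp_apply, RingHom.mem_ker.mp hp, map_zero]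
  · rw [Ideal.span_singleton_le_iff_mem, RingHom.mem_ker, map_sub, map_mul, hgCX, hgX, hgCC,
      splitVariable_X, if_pos rfl, map_mul, sub_self]

variable (K) in
theorem splitVariable_comp_fiberProd {V : Type*} [DecidableEq V] [Fintype W] (π : W → V)
    {w₁ w₂ : W} (h : w₁ ≠ w₂) (hπ : π w₁ = π w₂) :
    (splitVariable K h).comp (fiberProd K fun w : {w // w ≠ w₂} ↦ π w) = fiberProd K π := by
  refine MvPolynomial.algHom_ext fun v ↦ ?_
  rw [AlgHom.comp_apply, fiberProd_X, fiberProd_X, map_prod, Finset.prod_filter,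
    Finset.prod_filter, Fintype.prod_eq_mul_prod_subtype_ne _ w₂]
  have hX (w : {w // w ≠ w₂}) :
      (if π w = v then splitVariable K h (MvPolynomial.X w) else 1) =
        (if π w = v then MvPolynomial.X w.1 else 1) *
          (if w = ⟨w₁, h⟩ then if π w₁ = v then MvPolynomial.X w₂ else 1 else 1) := by
    rw [splitVariable_X]
    split_ifs <;> simp_all
  rw [Finset.prod_congr rfl fun w _ ↦ hX w, Finset.prod_mul_distrib, Finset.prod_ite_eq',
    if_pos (Finset.mem_univ _), hπ, mul_comm]

end Split

theorem isCohenMacaulayRing_quotient_map_fiberProd_iff (K : Type*) [Field K] {V : Type*}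
    [DecidableEq V] [Finite V] (J : Ideal (MvPolynomial V K)) {W : Type*} [Fintype W] (π : W → V)
    (hπ : Function.Surjective π) :
    IsCohenMacaulayRing (MvPolynomial W K ⧸ J.map (fiberProd K π)) ↔
      IsCohenMacaulayRing (MvPolynomial V K ⧸ J) := by
  classical
  by_cases hinj : Function.Injective π
  · let e := Equiv.ofBijective π ⟨hinj, hπ⟩
    refine isCohenMacaulayRing_congr
      (Ideal.quotientEquiv _ _ (MvPolynomial.renameEquiv K e.symm).toRingEquiv ?_).symm
    have : fiberProd K π = (MvPolynomial.renameEquiv K e.symm).toAlgHom := by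
      refine MvPolynomial.algHom_ext fun v ↦ ?_
      have hfib : ({w | π w = v} : Finset W) = {e.symm v} := by
        ext w
        rw [Finset.mem_filter_univ, Finset.mem_singleton]
        exact e.eq_symm_apply.symm
      rw [fiberProd_X, hfib, Finset.prod_singleton]
      exact (MvPolynomial.rename_X _ _).symm
    rw [this]
    rfl
  · obtain ⟨w₁, w₂, hw, hne⟩ : ∃ w₁ w₂, π w₁ = π w₂ ∧ w₁ ≠ w₂ := by
      simpa [Function.Injective] using hinj
    let π' : {w // w ≠ w₂} → V := fun w ↦ π w
    have hπ' : Function.Surjective π' := fun v ↦ by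
      obtain ⟨w, rfl⟩ := hπ v
      by_cases h : w = w₂
      · exact ⟨⟨w₁, hne⟩, by rw [h, ← hw]⟩
      · exact ⟨⟨w, h⟩, rfl⟩
    rw [← isCohenMacaulayRing_quotient_map_fiberProd_iff K J π' hπ']
    have hmap : (J.map (fiberProd K π')).map (splitVariable K hne) = J.map (fiberProd K π) := by
      rw [← splitVariable_comp_fiberProd K π hne hw]
      exact Ideal.map_map _ _
    obtain ⟨g, hg, hker⟩ := exists_surjective_ker_eq_span_of_splitVariable hne
      (Ideal.Quotient.mk_surjective (I := J.map (fiberProd K π')))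
      (Ideal.Quotient.mk_surjective (I := J.map (fiberProd K π)))
      (by rw [Ideal.mk_ker, Ideal.mk_ker, hmap])
    rw [isCohenMacaulayRing_iff_of_ker_eq_span hg hker]
termination_by Nat.card W
decreasing_by exact Finite.card_subtype_lt (x := w₂) (by simp)

/-- `S/J_Δ` is Cohen-Macaulay iff `S^α/J_{Δ^α}` is Cohen-Macaulay. -/
theorem isCohenMacaulay_dualFacetIdeal_expansion_iff (n : ℕ) (K : Type*) [Field K]
    (Δ : Set (Finset (Fin n))) (hΔ : IsComplex Δ)
    (α : Fin n → ℕ) (hα : ∀ i, 1 ≤ α i) :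
    IsCohenMacaulayRing (MvPolynomial (Fin n) K ⧸ dualFacetIdeal K Δ) ↔
      IsCohenMacaulayRing
        (MvPolynomial ((i : Fin n) × Fin (α i)) K ⧸ dualFacetIdeal K (expansion Δ α)) := by
  rw [dualFacetIdeal_expansion hΔ hα]
  exact (isCohenMacaulayRing_quotient_map_fiberProd_iff K _ _ fun i ↦ ⟨⟨i, ⟨0, hα i⟩⟩, rfl⟩).symm
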